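/- arXiv:math/0511148 — 2 statements merged into one kernel-verified Lean document; each statement's English description precedes it below -/
import Mathlib

section
/- The second Rogers–Ramanujan identity: for a complex number q with |q| < 1, ∑_{k=0}^∞ q^{k(k+1)} / (q;q)_k = 1 / ((q²;q⁵)_∞ (q³;q⁵)_∞). -/
/-- The finite `q`-shifted factorial `(a;q)_k` (here used as `(a;p)_k`). -/
noncomputable def qPoch (a q : ℂ) (k : ℕ) : ℂ := ∏ j ∈ Finset.range k, (1 - a * q ^ j)

/-- The infinite `q`-shifted factorial `(a;q)_∞` (here used as `(a;p)_∞`). -/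
noncomputable def qPochInf (a q : ℂ) : ℂ := ∏' j : ℕ, (1 - a * q ^ j)

open Filter Topology

/-- The reciprocal `1 / (q;q)_n`. -/
noncomputable def invQPoch (q : ℂ) (n : ℕ) : ℂ := (qPoch q q n)⁻¹

lemma one_sub_pow_ne_zero {q : ℂ} (hq : ‖q‖ < 1) {n : ℕ} (hn : n ≠ 0) : 1 - q ^ n ≠ 0 := by
  intro h
  have h1 : ‖q ^ n‖ = 1 := by rw [← sub_eq_zero.mp h, norm_one]
  rw [norm_pow] at h1
  exact (pow_lt_one₀ (norm_nonneg q) hq hn).ne h1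

lemma qPoch_succ (a q : ℂ) (n : ℕ) : qPoch a q (n + 1) = qPoch a q n * (1 - a * q ^ n) :=
  Finset.prod_range_succ _ _

lemma invQPoch_zero (q : ℂ) : invQPoch q 0 = 1 := by simp [invQPoch, qPoch]

lemma one_sub_pow_mul_invQPoch {q : ℂ} (hq : ‖q‖ < 1) (n : ℕ) :
    (1 - q ^ (n + 1)) * invQPoch q (n + 1) = invQPoch q n := by
  have := one_sub_pow_ne_zero hq n.succ_ne_zero
  rw [invQPoch, invQPoch, qPoch_succ, ← pow_succ', mul_inv]
  field_simp

/-- Pascal-type recursion for sums weighted by `1 / ((q;q)_j (q;q)_{n-j})`. -/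
lemma one_sub_pow_mul_sum {q : ℂ} (hq : ‖q‖ < 1) (f : ℕ → ℂ) (n : ℕ) :
    (1 - q ^ (n + 1)) *
        ∑ j ∈ Finset.range (n + 2), f j * (invQPoch q j * invQPoch q (n + 1 - j)) =
      ∑ j ∈ Finset.range (n + 1), f j * (invQPoch q j * invQPoch q (n - j)) +
      ∑ j ∈ Finset.range (n + 1),
        f (j + 1) * q ^ (n - j) * (invQPoch q j * invQPoch q (n - j)) := by
  have h : ∀ j ∈ Finset.range (n + 2),
      (1 - q ^ (n + 1)) * (f j * (invQPoch q j * invQPoch q (n + 1 - j))) =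
      f j * (invQPoch q j * ((1 - q ^ (n + 1 - j)) * invQPoch q (n + 1 - j))) +
      f j * q ^ (n + 1 - j) * ((1 - q ^ j) * invQPoch q j * invQPoch q (n + 1 - j)) := by
    intro j hj
    have hj' : j ≤ n + 1 := by simpa [Nat.lt_succ_iff] using hj
    have : q ^ (n + 1) = q ^ (n + 1 - j) * q ^ j := by rw [← pow_add, Nat.sub_add_cancel hj']
    rw [this]; ring
  rw [Finset.mul_sum, Finset.sum_congr rfl h, Finset.sum_add_distrib]
  congr 1
  · rw [Finset.sum_range_succ]
    simp only [Nat.sub_self, pow_zero, sub_self, zero_mul, mul_zero, add_zero]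
    refine Finset.sum_congr rfl fun j hj => ?_
    have hj' : j ≤ n := by simpa [Nat.lt_succ_iff] using hj
    rw [Nat.succ_sub hj', one_sub_pow_mul_invQPoch hq]
  · rw [Finset.sum_range_succ']
    simp only [pow_zero, sub_self, zero_mul, mul_zero, add_zero]
    refine Finset.sum_congr rfl fun j _ => ?_
    rw [one_sub_pow_mul_invQPoch hq, Nat.add_sub_add_right]

/-- The companion recursion, with the roles of `j` and `n - j` exchanged. -/
lemma one_sub_pow_mul_sum' {q : ℂ} (hq : ‖q‖ < 1) (f : ℕ → ℂ) (n : ℕ) :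
    (1 - q ^ (n + 1)) *
        ∑ j ∈ Finset.range (n + 2), f j * (invQPoch q j * invQPoch q (n + 1 - j)) =
      ∑ j ∈ Finset.range (n + 1), f j * q ^ j * (invQPoch q j * invQPoch q (n - j)) +
      ∑ j ∈ Finset.range (n + 1), f (j + 1) * (invQPoch q j * invQPoch q (n - j)) := by
  have key := one_sub_pow_mul_sum hq (fun j => f (n + 1 - j)) n
  have h1 := Finset.sum_range_reflect
    (fun j => f j * (invQPoch q j * invQPoch q (n + 1 - j))) (n + 2)
  have h2 := Finset.sum_range_reflect
    (fun j => f j * q ^ j * (invQPoch q j * invQPoch q (n - j))) (n + 1)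
  have h3 := Finset.sum_range_reflect
    (fun j => f (j + 1) * (invQPoch q j * invQPoch q (n - j))) (n + 1)
  rw [← h1, ← h2, ← h3, add_comm (Finset.sum _ _)]
  convert key using 2
  · refine Finset.sum_congr rfl fun j hj => ?_
    have hj' := Finset.mem_range.mp hj
    rw [show n + 2 - 1 - j = n + 1 - j by omega, show n + 1 - (n + 1 - j) = j by omega]
    ring
  · refine Finset.sum_congr rfl fun j hj => ?_
    have hj' := Finset.mem_range.mp hj
    rw [show n + 1 - 1 - j + 1 = n + 1 - j by omega, show n + 1 - 1 - j = n - j by omega,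
      show n - (n - j) = j by omega]
    ring
  · refine Finset.sum_congr rfl fun j hj => ?_
    have hj' := Finset.mem_range.mp hj
    rw [show n + 1 - 1 - j = n - j by omega, show n + 1 - (j + 1) = n - j by omega,
      show n - (n - j) = j by omega]
    ring

/-- A form of the `q`-Chu–Vandermonde summation. -/
lemma qVandermonde {q : ℂ} (hq : ‖q‖ < 1) (m c : ℕ) :
    ∑ t ∈ Finset.range (m + 1),
        q ^ (t * (t + c)) * invQPoch q (t + c) * (invQPoch q t * invQPoch q (m - t)) =
      invQPoch q m * invQPoch q (m + c) := by
  induction m generalizing c with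
  | zero => simp [invQPoch_zero]
  | succ m ih =>
    refine mul_left_cancel₀ (one_sub_pow_ne_zero hq m.succ_ne_zero) ?_
    have h := one_sub_pow_mul_sum hq (fun t => q ^ (t * (t + c)) * invQPoch q (t + c)) m
    have h2 : ∑ t ∈ Finset.range (m + 1), q ^ ((t + 1) * (t + 1 + c)) * invQPoch q (t + 1 + c) *
          q ^ (m - t) * (invQPoch q t * invQPoch q (m - t)) =
        q ^ (m + c + 1) * (invQPoch q m * invQPoch q (m + (c + 1))) := by
      rw [← ih (c + 1), Finset.mul_sum]
      refine Finset.sum_congr rfl fun t ht => ?_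
      have ht' : t ≤ m := by simpa [Nat.lt_succ_iff] using ht
      have : q ^ ((t + 1) * (t + 1 + c)) * q ^ (m - t) =
          q ^ (m + c + 1) * q ^ (t * (t + (c + 1))) := by
        obtain ⟨d, rfl⟩ := Nat.exists_eq_add_of_le ht'
        rw [Nat.add_sub_cancel_left]; ring
      rw [show t + 1 + c = t + (c + 1) by ring] at this ⊢
      linear_combination (invQPoch q (t + (c + 1)) * (invQPoch q t * invQPoch q (m - t))) * this
    rw [h, h2, ih c, Nat.succ_eq_add_one, ← mul_assoc (1 - q ^ (m + 1)),
      one_sub_pow_mul_invQPoch hq,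
      show m + 1 + c = m + c + 1 by ring, ← one_sub_pow_mul_invQPoch hq (m + c),
      show m + (c + 1) = m + c + 1 by ring]
    ring

lemma sum_triangle_comm (F : ℕ → ℕ → ℂ) (L : ℕ) :
    ∑ s ∈ Finset.range (L + 1), ∑ r ∈ Finset.range (s + 1), F s r =
      ∑ r ∈ Finset.range (L + 1), ∑ t ∈ Finset.range (L - r + 1), F (r + t) r := by
  rw [Finset.sum_comm' (t' := Finset.range (L + 1)) (s' := fun r => Finset.Ico r (L + 1))]
  · refine Finset.sum_congr rfl fun r hr => ?_
    have hr' := Finset.mem_range.mp hr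
    rw [Finset.sum_Ico_eq_sum_range, show L + 1 - r = L - r + 1 by omega]
  · intro s r
    simp only [Finset.mem_range, Finset.mem_Ico]
    omega

/-- The `β`-sequence of the Bailey pair relative to `q` whose `α`-sequence is given. -/
noncomputable def baileySum (q : ℂ) (α : ℕ → ℂ) (L : ℕ) : ℂ :=
  ∑ r ∈ Finset.range (L + 1), α r * (invQPoch q (L - r) * invQPoch q (L + r + 1))

/-- A limiting case of Bailey's lemma relative to `q`. -/
lemma baileySum_step {q : ℂ} (hq : ‖q‖ < 1) (α : ℕ → ℂ) (L : ℕ) :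
    baileySum q (fun r => q ^ (r * (r + 1)) * α r) L =
      ∑ s ∈ Finset.range (L + 1), q ^ (s * (s + 1)) * baileySum q α s * invQPoch q (L - s) := by
  have h : ∀ s ∈ Finset.range (L + 1),
      q ^ (s * (s + 1)) * baileySum q α s * invQPoch q (L - s) =
      ∑ r ∈ Finset.range (s + 1), q ^ (s * (s + 1)) *
        (α r * (invQPoch q (s - r) * invQPoch q (s + r + 1))) * invQPoch q (L - s) := by
    intro s _
    rw [baileySum, Finset.mul_sum, Finset.sum_mul]
  rw [Finset.sum_congr rfl h, sum_triangle_comm, baileySum]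
  refine Finset.sum_congr rfl fun r hr => ?_
  have hr' : r ≤ L := by simpa [Nat.lt_succ_iff] using hr
  have hv := qVandermonde hq (L - r) (2 * r + 1)
  rw [show L + r + 1 = L - r + (2 * r + 1) by omega, ← hv, Finset.mul_sum]
  refine Finset.sum_congr rfl fun t _ => ?_
  rw [show r + t - r = t by omega, show r + t + r + 1 = t + (2 * r + 1) by ring,
    show L - (r + t) = L - r - t by omega,
    show (r + t) * (r + t + 1) = r * (r + 1) + t * (t + (2 * r + 1)) by ring, pow_add]
  ring

/-- The binomial coefficient `r (r - 1) / 2` of an integer `r`, as a natural number. -/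
def intTri (r : ℤ) : ℕ := (r * (r - 1) / 2).toNat

lemma two_mul_intTri (r : ℤ) : 2 * (intTri r : ℤ) = r * (r - 1) := by
  have he : Even (r * (r - 1)) := Int.even_mul_pred_self r
  have hn : 0 ≤ r * (r - 1) := by
    rcases le_or_gt r 0 with h | h
    · exact mul_nonneg_of_nonpos_of_nonpos h (by omega)
    · exact mul_nonneg h.le (by omega)
  rw [intTri, Int.toNat_of_nonneg (Int.ediv_nonneg hn (by norm_num))]
  exact Int.two_mul_ediv_two_of_even he

/-- The general term `(-1)^r x^{r(r+1)/2} y^{r(r-1)/2}` of the two-sided theta series. -/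
noncomputable def thetaTerm (x y : ℂ) (r : ℤ) : ℂ :=
  (-1) ^ r * x ^ intTri (r + 1) * y ^ intTri r

lemma thetaTerm_add_one_mul (x y : ℂ) (r : ℤ) (b k : ℕ) (h : (k : ℤ) = b - r) :
    thetaTerm x y (r + 1) * (x * y) ^ k = -(x * (x * y) ^ b) * thetaTerm x y r := by
  have h0 := two_mul_intTri r
  have h1 := two_mul_intTri (r + 1)
  have h2 := two_mul_intTri (r + 1 + 1)
  have hx : intTri (r + 1 + 1) + k = 1 + b + intTri (r + 1) := by
    zify; linarith
  have hy : intTri (r + 1) + k = b + intTri r := by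
    zify; linarith
  have hx' := congrArg (x ^ ·) hx
  have hy' := congrArg (y ^ ·) hy
  simp only [pow_add, pow_one] at hx' hy'
  rw [thetaTerm, thetaTerm, zpow_add_one₀ (by norm_num), mul_pow, mul_pow]
  linear_combination (-(-1 : ℂ) ^ r * (y ^ intTri (r + 1) * y ^ k)) * hx' -
    (-1 : ℂ) ^ r * (x * x ^ b * x ^ intTri (r + 1)) * hy'

lemma thetaTerm_sub_one_mul (x y : ℂ) (r : ℤ) (a k : ℕ) (h : (k : ℤ) = a + r) :
    thetaTerm x y (r - 1) * (x * y) ^ k = -(y * (x * y) ^ a) * thetaTerm x y r := by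
  have h0 := two_mul_intTri r
  have h1 := two_mul_intTri (r + 1)
  have h2 := two_mul_intTri (r - 1)
  have hx : intTri r + k = a + intTri (r + 1) := by
    zify; linarith
  have hy : intTri (r - 1) + k = 1 + a + intTri r := by
    zify; linarith
  have hx' := congrArg (x ^ ·) hx
  have hy' := congrArg (y ^ ·) hy
  simp only [pow_add, pow_one] at hx' hy'
  rw [thetaTerm, thetaTerm, zpow_sub_one₀ (by norm_num), mul_pow, mul_pow, sub_add_cancel,
    show ((-1 : ℂ))⁻¹ = -1 by norm_num]
  linear_combination (-(-1 : ℂ) ^ r * (y ^ intTri (r - 1) * y ^ k)) * hx' -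
    (-1 : ℂ) ^ r * (x ^ a * x ^ intTri (r + 1)) * hy'

/-- The finite form of the Jacobi triple product identity. -/
lemma finite_triple_product {x y : ℂ} (hxy : ‖x * y‖ < 1) (a b : ℕ) :
    ∑ j ∈ Finset.range (a + b + 1), thetaTerm x y (j - a) *
        (invQPoch (x * y) j * invQPoch (x * y) (a + b - j)) =
      qPoch x (x * y) b * qPoch y (x * y) a * invQPoch (x * y) (a + b) := by
  induction a with
  | zero =>
    induction b with
    | zero => simp [thetaTerm, intTri, invQPoch_zero, qPoch]
    | succ b ih =>
      refine mul_left_cancel₀ (one_sub_pow_ne_zero hxy (0 + b).succ_ne_zero) ?_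
      have h := one_sub_pow_mul_sum hxy (fun j => thetaTerm x y (j - (0 : ℕ))) (0 + b)
      have h2 : ∑ j ∈ Finset.range (0 + b + 1), thetaTerm x y ((j + 1 : ℕ) - (0 : ℕ)) *
            (x * y) ^ (0 + b - j) * (invQPoch (x * y) j * invQPoch (x * y) (0 + b - j)) =
          -(x * (x * y) ^ b) *
            (qPoch x (x * y) b * qPoch y (x * y) 0 * invQPoch (x * y) (0 + b)) := by
        rw [← ih, Finset.mul_sum]
        refine Finset.sum_congr rfl fun j hj => ?_
        have hj' := Finset.mem_range.mp hj
        rw [← mul_assoc (-_), ← thetaTerm_add_one_mul x y _ b (0 + b - j) (by push_cast; omega)]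
        congr 3
      refine h.trans ?_
      rw [h2, ih, qPoch_succ, ← one_sub_pow_mul_invQPoch hxy (0 + b)]
      simp only [Nat.succ_eq_add_one, ← add_assoc]
      ring
  | succ a ih =>
    rw [show a + 1 + b = a + b + 1 by ring]
    refine mul_left_cancel₀ (one_sub_pow_ne_zero hxy (a + b).succ_ne_zero) ?_
    have h := one_sub_pow_mul_sum' hxy (fun j => thetaTerm x y (j - (a + 1 : ℕ))) (a + b)
    have h2 : ∑ j ∈ Finset.range (a + b + 1), thetaTerm x y (j - (a + 1 : ℕ)) *
          (x * y) ^ j * (invQPoch (x * y) j * invQPoch (x * y) (a + b - j)) =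
        -(y * (x * y) ^ a) *
          (qPoch x (x * y) b * qPoch y (x * y) a * invQPoch (x * y) (a + b)) := by
      rw [← ih, Finset.mul_sum]
      refine Finset.sum_congr rfl fun j _ => ?_
      rw [← mul_assoc (-_), ← thetaTerm_sub_one_mul x y _ a j (by ring)]
      congr 3
      push_cast; ring
    have h3 : ∑ j ∈ Finset.range (a + b + 1), thetaTerm x y ((j + 1 : ℕ) - (a + 1 : ℕ)) *
          (invQPoch (x * y) j * invQPoch (x * y) (a + b - j)) =
        qPoch x (x * y) b * qPoch y (x * y) a * invQPoch (x * y) (a + b) := by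
      rw [← ih]
      refine Finset.sum_congr rfl fun j _ => ?_
      congr 2
      push_cast; ring
    refine h.trans ?_
    rw [h2, h3, qPoch_succ, ← one_sub_pow_mul_invQPoch hxy (a + b)]
    simp only [Nat.succ_eq_add_one]
    ring

/-- The theta series folded onto the nonnegative integers. -/
noncomputable def foldedTheta (x y : ℂ) (r : ℕ) : ℂ :=
  thetaTerm x y r + thetaTerm x y (-1 - r)

lemma baileySum_foldedTheta {x y : ℂ} (hxy : ‖x * y‖ < 1) (L : ℕ) :
    baileySum (x * y) (foldedTheta x y) L =
      qPoch x (x * y) L * qPoch y (x * y) (L + 1) * invQPoch (x * y) (2 * L + 1) := by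
  have h := finite_triple_product hxy (L + 1) L
  rw [show L + 1 + L + 1 = (L + 1) + (L + 1) by ring, Finset.sum_range_add,
    ← Finset.sum_range_reflect _ (L + 1), ← Finset.sum_add_distrib] at h
  rw [show 2 * L + 1 = L + 1 + L by ring, ← h, baileySum]
  refine Finset.sum_congr rfl fun r hr => ?_
  have hr' : r ≤ L := by simpa [Nat.lt_succ_iff] using hr
  rw [show L + 1 - 1 - r = L - r by omega, show L + 1 + L - (L - r) = L + r + 1 by omega,
    show L + 1 + L - (L + 1 + r) = L - r by omega, show L + 1 + r = L + r + 1 by ring,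
    show ((L - r : ℕ) : ℤ) - (L + 1 : ℕ) = -1 - r by push_cast [hr']; ring,
    show ((L + r + 1 : ℕ) : ℤ) - (L + 1 : ℕ) = r by push_cast; ring, foldedTheta]
  ring

/-- The unit Bailey pair relative to `q`. -/
lemma baileySum_unit {q : ℂ} (hq : ‖q‖ < 1) (L : ℕ) :
    baileySum q (foldedTheta 1 q) L = if L = 0 then 1 else 0 := by
  have h := baileySum_foldedTheta (x := 1) (y := q) (by rwa [one_mul]) L
  rw [one_mul] at h
  rw [h]
  cases L with
  | zero =>
    have := one_sub_pow_mul_invQPoch hq 0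
    simpa [qPoch, invQPoch_zero] using this
  | succ L => simp [qPoch, Finset.prod_range_succ']

lemma foldedTheta_pow_four (q : ℂ) (r : ℕ) :
    q ^ (r * (r + 1)) * (q ^ (r * (r + 1)) * foldedTheta 1 q r) = foldedTheta (q ^ 4) q r := by
  have h1 := two_mul_intTri (r + 1)
  have h2 := two_mul_intTri (-1 - r + 1)
  have e1 : 4 * intTri (r + 1) = r * (r + 1) + r * (r + 1) := by zify; linarith
  have e2 : 4 * intTri (-1 - r + 1) = r * (r + 1) + r * (r + 1) := by zify; linarith
  simp only [foldedTheta, thetaTerm, one_pow, ← pow_mul, e1, e2, pow_add]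
  ring

/-- A finite identity which tends to the second Rogers–Ramanujan identity. -/
lemma baileySum_pow_four {q : ℂ} (hq : ‖q‖ < 1) (L : ℕ) :
    baileySum q (foldedTheta (q ^ 4) q) L =
      ∑ s ∈ Finset.range (L + 1), q ^ (s * (s + 1)) * invQPoch q s * invQPoch q (L - s) := by
  have h1 : ∀ s, baileySum q (fun r => q ^ (r * (r + 1)) * foldedTheta 1 q r) s =
      invQPoch q s := by
    intro s
    rw [baileySum_step hq, Finset.sum_eq_single_of_mem 0 (by simp)]
    · simp [baileySum_unit hq]
    · intro t _ ht
      simp [baileySum_unit hq, ht]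
  have h2 := baileySum_step hq (fun r => q ^ (r * (r + 1)) * foldedTheta 1 q r) L
  simp only [foldedTheta_pow_four, h1] at h2
  exact h2

lemma summable_norm_mul_pow (a : ℂ) {q : ℂ} (hq : ‖q‖ < 1) :
    Summable fun j : ℕ => ‖-(a * q ^ j)‖ := by
  simp only [norm_neg, norm_mul, norm_pow]
  exact (summable_geometric_of_lt_one (norm_nonneg q) hq).mul_left _

lemma tendsto_qPoch (a : ℂ) {q : ℂ} (hq : ‖q‖ < 1) :
    Tendsto (qPoch a q) atTop (𝓝 (qPochInf a q)) := by
  have h := (multipliable_one_add_of_summable (summable_norm_mul_pow a hq)).tendsto_prod_tprod_nat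
  simp only [← sub_eq_add_neg] at h
  exact h

lemma qPochInf_self_ne_zero {q : ℂ} (hq : ‖q‖ < 1) : qPochInf q q ≠ 0 := by
  have h := tprod_one_add_ne_zero_of_summable (f := fun j : ℕ => -(q * q ^ j))
    (fun j => by
      rw [← sub_eq_add_neg, ← pow_succ']
      exact one_sub_pow_ne_zero hq j.succ_ne_zero)
    (summable_norm_mul_pow q hq)
  simp only [← sub_eq_add_neg] at h
  exact h

lemma tendsto_invQPoch {q : ℂ} (hq : ‖q‖ < 1) :
    Tendsto (invQPoch q) atTop (𝓝 (qPochInf q q)⁻¹) :=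
  (tendsto_qPoch q hq).inv₀ (qPochInf_self_ne_zero hq)

lemma exists_norm_invQPoch_le {q : ℂ} (hq : ‖q‖ < 1) :
    ∃ C, ∀ n, ‖invQPoch q n‖ ≤ C := by
  obtain ⟨C, hC⟩ := (Metric.isBounded_range_of_tendsto _ (tendsto_invQPoch hq)).exists_norm_le
  exact ⟨C, fun n => hC _ ⟨n, rfl⟩⟩

/-- Tannery's theorem for sums over initial segments. -/
lemma tendsto_sum_range_mul {f : ℕ → ℂ} (hf : Summable fun r => ‖f r‖) {g : ℕ → ℕ → ℂ} {G : ℂ}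
    {C : ℝ} (hC : ∀ L r, ‖g L r‖ ≤ C) (hg : ∀ r, Tendsto (g · r) atTop (𝓝 G)) :
    Tendsto (fun L => ∑ r ∈ Finset.range (L + 1), f r * g L r) atTop (𝓝 ((∑' r, f r) * G)) := by
  have h := tendsto_tsum_of_dominated_convergence (𝓕 := atTop)
    (f := fun L r => if r ∈ Finset.range (L + 1) then f r * g L r else 0)
    (g := fun r => f r * G) (hf.mul_right C)
    (fun r => by
      refine ((hg r).const_mul (f r)).congr' ?_
      filter_upwards [eventually_ge_atTop r] with L hL
      rw [if_pos (Finset.mem_range.mpr (Nat.lt_succ_of_le hL))])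
    (Eventually.of_forall fun L r => by
      have hb : ‖f r * g L r‖ ≤ ‖f r‖ * C := by
        rw [norm_mul]
        exact mul_le_mul_of_nonneg_left (hC L r) (norm_nonneg _)
      split_ifs
      · exact hb
      · rw [norm_zero]
        exact (norm_nonneg _).trans hb)
  rw [tsum_mul_right] at h
  refine h.congr fun L => ?_
  rw [tsum_eq_sum (s := Finset.range (L + 1)) fun r hr => if_neg hr]
  exact Finset.sum_congr rfl fun r hr => if_pos hr

lemma tendsto_baileySum {q : ℂ} (hq : ‖q‖ < 1) {α : ℕ → ℂ} (hα : Summable fun r => ‖α r‖) :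
    Tendsto (baileySum q α) atTop (𝓝 ((∑' r, α r) * ((qPochInf q q)⁻¹ * (qPochInf q q)⁻¹))) := by
  obtain ⟨C, hC⟩ := exists_norm_invQPoch_le hq
  refine tendsto_sum_range_mul (C := C * C) hα (fun L r => ?_) fun r => ?_
  · rw [norm_mul]
    exact mul_le_mul (hC _) (hC _) (norm_nonneg _) ((norm_nonneg _).trans (hC 0))
  · refine ((tendsto_invQPoch hq).comp (tendsto_sub_atTop_nat r)).mul
      ((tendsto_invQPoch hq).comp ?_)
    exact tendsto_atTop_mono (fun L => by simp only [id]; omega) tendsto_id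

lemma summable_norm_pow_mul_invQPoch {q : ℂ} (hq : ‖q‖ < 1) :
    Summable fun s : ℕ => ‖q ^ (s * (s + 1)) * invQPoch q s‖ := by
  obtain ⟨C, hC⟩ := exists_norm_invQPoch_le hq
  refine Summable.of_nonneg_of_le (fun _ => norm_nonneg _) (fun s => ?_)
    ((summable_geometric_of_lt_one (norm_nonneg q) hq).mul_right C)
  rw [norm_mul, norm_pow]
  exact mul_le_mul (pow_le_pow_of_le_one (norm_nonneg q) hq.le (by nlinarith)) (hC s)
    (norm_nonneg _) (by positivity)

lemma norm_thetaTerm_pow_four_le {q : ℂ} (hq : ‖q‖ < 1) {k : ℤ} {r : ℕ}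
    (h : (r : ℤ) ≤ 2 * (k * (k + 1))) : ‖thetaTerm (q ^ 4) q k‖ ≤ ‖q‖ ^ r := by
  have h1 := two_mul_intTri (k + 1)
  rw [thetaTerm, mul_assoc, ← pow_mul, ← pow_add, norm_mul, norm_zpow, norm_neg, norm_one,
    one_zpow, one_mul, norm_pow]
  refine pow_le_pow_of_le_one (norm_nonneg q) hq.le ?_
  zify
  linarith [Int.natCast_nonneg (intTri k)]

lemma summable_norm_foldedTheta {q : ℂ} (hq : ‖q‖ < 1) :
    Summable fun r => ‖foldedTheta (q ^ 4) q r‖ := by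
  have hs := summable_geometric_of_lt_one (norm_nonneg q) hq
  refine Summable.of_nonneg_of_le (fun _ => norm_nonneg _) (fun r => ?_) (hs.add hs)
  exact (norm_add_le _ _).trans (add_le_add
    (norm_thetaTerm_pow_four_le hq (by nlinarith [Int.natCast_nonneg r]))
    (norm_thetaTerm_pow_four_le hq (by nlinarith [Int.natCast_nonneg r])))

/-- The theta series as an infinite product, by the Jacobi triple product identity. -/
lemma tsum_foldedTheta {q : ℂ} (hq : ‖q‖ < 1) :
    ∑' r, foldedTheta (q ^ 4) q r =
      qPochInf (q ^ 4) (q ^ 5) * qPochInf q (q ^ 5) * qPochInf (q ^ 5) (q ^ 5) := by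
  have h5 : ‖q ^ 5‖ < 1 := by
    rw [norm_pow]
    exact pow_lt_one₀ (norm_nonneg q) hq (by norm_num)
  have hne := qPochInf_self_ne_zero h5
  have h1 := tendsto_baileySum h5 (summable_norm_foldedTheta hq)
  have h2 : Tendsto (baileySum (q ^ 5) (foldedTheta (q ^ 4) q)) atTop
      (𝓝 (qPochInf (q ^ 4) (q ^ 5) * qPochInf q (q ^ 5) * (qPochInf (q ^ 5) (q ^ 5))⁻¹)) := by
    have h : ∀ L, qPoch (q ^ 4) (q ^ 5) L * qPoch q (q ^ 5) (L + 1) *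
        invQPoch (q ^ 5) (2 * L + 1) = baileySum (q ^ 5) (foldedTheta (q ^ 4) q) L := by
      intro L
      have := baileySum_foldedTheta (x := q ^ 4) (y := q) (by rwa [← pow_succ]) L
      rw [← pow_succ] at this
      exact this.symm
    refine Tendsto.congr h (((tendsto_qPoch _ h5).mul
      ((tendsto_qPoch _ h5).comp (tendsto_add_atTop_nat 1))).mul
      ((tendsto_invQPoch h5).comp ?_))
    exact tendsto_atTop_mono (fun L => by simp only [id]; omega) tendsto_id
  have h := tendsto_nhds_unique h1 h2
  field_simp at h
  linear_combination h

/-- Dissection of `(q;q)_∞` modulo `5`. -/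
lemma qPochInf_dissection {q : ℂ} (hq : ‖q‖ < 1) :
    qPochInf q q = qPochInf q (q ^ 5) * qPochInf (q ^ 2) (q ^ 5) * qPochInf (q ^ 3) (q ^ 5) *
      qPochInf (q ^ 4) (q ^ 5) * qPochInf (q ^ 5) (q ^ 5) := by
  have h5 : ‖q ^ 5‖ < 1 := by
    rw [norm_pow]
    exact pow_lt_one₀ (norm_nonneg q) hq (by norm_num)
  have h : ∀ n, qPoch q q (5 * n) = qPoch q (q ^ 5) n * qPoch (q ^ 2) (q ^ 5) n *
      qPoch (q ^ 3) (q ^ 5) n * qPoch (q ^ 4) (q ^ 5) n * qPoch (q ^ 5) (q ^ 5) n := by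
    intro n
    induction n with
    | zero => simp [qPoch]
    | succ n ih =>
      rw [show 5 * (n + 1) = 5 * n + 1 + 1 + 1 + 1 + 1 by ring]
      simp only [qPoch_succ, ih]
      ring
  have h1 : Tendsto (fun n => qPoch q q (5 * n)) atTop (𝓝 (qPochInf q q)) :=
    (tendsto_qPoch q hq).comp
      (tendsto_atTop_mono (fun n => by simp only [id]; omega) tendsto_id)
  refine tendsto_nhds_unique h1 (Tendsto.congr (fun n => (h n).symm) ?_)
  exact ((((tendsto_qPoch _ h5).mul (tendsto_qPoch _ h5)).mul (tendsto_qPoch _ h5)).mul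
    (tendsto_qPoch _ h5)).mul (tendsto_qPoch _ h5)

/-- The second Rogers–Ramanujan identity: for `‖q‖ < 1`,
`∑_{k=0}^∞ q^{k(k+1)} / (q;q)_k = 1 / ((q²;q⁵)_∞ (q³;q⁵)_∞)`. -/
theorem rogers_ramanujan_second (q : ℂ) (hq : ‖q‖ < 1) :
    HasSum (fun k : ℕ => q ^ (k * (k + 1)) / qPoch q q k)
      (1 / (qPochInf (q ^ 2) (q ^ 5) * qPochInf (q ^ 3) (q ^ 5))) := by
  have hs := summable_norm_pow_mul_invQPoch hq
  obtain ⟨C, hC⟩ := exists_norm_invQPoch_le hq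
  have h1 := tendsto_sum_range_mul (g := fun L s => invQPoch q (L - s)) hs
    (fun L s => hC (L - s)) fun s => (tendsto_invQPoch hq).comp (tendsto_sub_atTop_nat s)
  have h2 := tendsto_nhds_unique (h1.congr fun L => (baileySum_pow_four hq L).symm)
    (tendsto_baileySum hq (summable_norm_foldedTheta hq))
  have hne := qPochInf_self_ne_zero hq
  have hA : ∑' s, q ^ (s * (s + 1)) * invQPoch q s =
      1 / (qPochInf (q ^ 2) (q ^ 5) * qPochInf (q ^ 3) (q ^ 5)) := by
    rw [tsum_foldedTheta hq, ← mul_assoc] at h2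
    rw [mul_right_cancel₀ (inv_ne_zero hne) h2]
    rw [qPochInf_dissection hq] at hne ⊢
    simp only [mul_ne_zero_iff] at hne
    obtain ⟨⟨⟨⟨_, _⟩, _⟩, _⟩, _⟩ := hne
    field_simp
  rw [← hA]
  exact hs.of_norm.hasSum
end

section
/- Generating function for the continuous q-ultraspherical polynomials: for a real number q with 0 < q < 1, a real number β with −1 < β < 1, θ ∈ [0, π], and a complex number z with |z| < 1, one has ((β e^{iθ} z;q)_∞ (β e^{−iθ} z;q)_∞) / ((e^{iθ} z;q)_∞ (e^{−iθ} z;q)_∞) = ∑_{n=0}^∞ C_n(cos θ; β | q) z^n. -/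
open Complex

/-- The continuous `q`-ultraspherical polynomial `C_n(cos θ; β | q)`, defined by its
finite Fourier sum `∑_{k=0}^n ((β;q)_k (β;q)_{n−k}) / ((q;q)_k (q;q)_{n−k}) e^{i(n−2k)θ}`. -/
noncomputable def qUltra (q β : ℝ) (n : ℕ) (θ : ℝ) : ℂ :=
  ∑ k ∈ Finset.range (n + 1),
    qPoch (β : ℂ) (q : ℂ) k * qPoch (β : ℂ) (q : ℂ) (n - k) /
      (qPoch (q : ℂ) (q : ℂ) k * qPoch (q : ℂ) (q : ℂ) (n - k)) *
      Complex.exp (I * ((n : ℂ) - 2 * (k : ℂ)) * (θ : ℂ))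

open Filter Topology

/-- The coefficient `(a;q)_n / (q;q)_n` of the `q`-binomial series. -/
noncomputable def qBinomCoeff (a q : ℂ) (n : ℕ) : ℂ := qPoch a q n / qPoch q q n

lemma one_sub_pow_succ_ne_zero {q : ℂ} (hq : ‖q‖ < 1) (n : ℕ) : 1 - q ^ (n + 1) ≠ 0 := by
  intro h
  have h1 : ‖q ^ (n + 1)‖ < 1 := by
    rw [norm_pow]
    exact pow_lt_one₀ (norm_nonneg q) hq n.succ_ne_zero
  rw [← sub_eq_zero.mp h, norm_one] at h1
  exact lt_irrefl 1 h1

lemma qBinomCoeff_zero (a q : ℂ) : qBinomCoeff a q 0 = 1 := by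
  simp [qBinomCoeff, qPoch]

lemma qBinomCoeff_succ (a q : ℂ) (n : ℕ) :
    qBinomCoeff a q (n + 1) = qBinomCoeff a q n * ((1 - a * q ^ n) / (1 - q ^ (n + 1))) := by
  simp only [qBinomCoeff, qPoch, Finset.prod_range_succ, pow_succ']
  rw [mul_div_mul_comm]

lemma summable_norm_qBinomCoeff_mul_pow {q x : ℂ} (hq : ‖q‖ < 1) (hx : ‖x‖ < 1) (a : ℂ) :
    Summable fun n => ‖qBinomCoeff a q n * x ^ n‖ := by
  obtain ⟨r, hxr, hr⟩ := exists_between hx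
  have hpow : Tendsto (fun n : ℕ => q ^ n) atTop (𝓝 0) :=
    tendsto_pow_atTop_nhds_zero_of_norm_lt_one hq
  have hlim : Tendsto (fun n : ℕ => ‖(1 - a * q ^ n) / (1 - q ^ (n + 1)) * x‖) atTop (𝓝 ‖x‖) := by
    have h := ((((hpow.const_mul a).const_sub 1).div
      ((hpow.comp (tendsto_add_atTop_nat 1)).const_sub 1) (by simp)).mul_const x).norm
    simpa using h
  refine summable_of_ratio_norm_eventually_le hr ?_
  filter_upwards [hlim.eventually_le_const hxr] with n hn
  rw [norm_norm, norm_norm, qBinomCoeff_succ, pow_succ x,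
    show ∀ b c d e : ℂ, b * c * (d * e) = c * e * (b * d) by intros; ring, norm_mul]
  exact mul_le_mul_of_nonneg_right hn (norm_nonneg _)

lemma norm_mul_lt_one_of_lt {q x : ℂ} (hq : ‖q‖ < 1) (hx : ‖x‖ < 1) : ‖q * x‖ < 1 := by
  rw [norm_mul]
  exact mul_lt_one_of_nonneg_of_lt_one_left (norm_nonneg q) hq hx.le

lemma one_sub_mul_tsum_qBinomCoeff {q x : ℂ} (hq : ‖q‖ < 1) (hx : ‖x‖ < 1) (a : ℂ) :
    (1 - x) * ∑' n, qBinomCoeff a q n * x ^ n =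
      (1 - a * x) * ∑' n, qBinomCoeff a q n * (q * x) ^ n := by
  have hs := (summable_norm_qBinomCoeff_mul_pow hq hx a).of_norm
  have hsq := (summable_norm_qBinomCoeff_mul_pow hq (norm_mul_lt_one_of_lt hq hx) a).of_norm
  have hdiff := hs.tsum_sub hsq
  rw [(hs.sub hsq).tsum_eq_zero_add] at hdiff
  have hterm : ∀ n, qBinomCoeff a q (n + 1) * x ^ (n + 1) -
      qBinomCoeff a q (n + 1) * (q * x) ^ (n + 1) =
      x * (qBinomCoeff a q n * x ^ n - a * (qBinomCoeff a q n * (q * x) ^ n)) := by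
    intro n
    have h := one_sub_pow_succ_ne_zero hq n
    rw [qBinomCoeff_succ, mul_pow, mul_pow]
    field_simp
    ring
  simp only [hterm] at hdiff
  rw [tsum_mul_left, hs.tsum_sub (hsq.mul_left a), tsum_mul_left] at hdiff
  simp only [pow_zero, sub_self, zero_add] at hdiff
  linear_combination -hdiff

lemma norm_pow_mul_lt_one {q x : ℂ} (hq : ‖q‖ < 1) (hx : ‖x‖ < 1) (N : ℕ) :
    ‖q ^ N * x‖ < 1 := by
  induction N with
  | zero => simpa using hx
  | succ N ih => rw [pow_succ', mul_assoc]; exact norm_mul_lt_one_of_lt hq ih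

lemma qPoch_mul_tsum_qBinomCoeff {q x : ℂ} (hq : ‖q‖ < 1) (hx : ‖x‖ < 1) (a : ℂ) (N : ℕ) :
    qPoch x q N * ∑' n, qBinomCoeff a q n * x ^ n =
      qPoch (a * x) q N * ∑' n, qBinomCoeff a q n * (q ^ N * x) ^ n := by
  induction N with
  | zero => simp [qPoch]
  | succ N ih =>
    have h := one_sub_mul_tsum_qBinomCoeff hq (norm_pow_mul_lt_one hq hx N) a
    rw [← mul_assoc q, ← pow_succ'] at h
    have hsucc : ∀ b : ℂ, qPoch b q (N + 1) = qPoch b q N * (1 - b * q ^ N) :=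
      fun b => Finset.prod_range_succ _ _
    rw [hsucc, hsucc]
    linear_combination (1 - x * q ^ N) * ih + qPoch (a * x) q N * h

lemma tendsto_qPoch_qPochInf {q : ℂ} (hq : ‖q‖ < 1) (a : ℂ) :
    Tendsto (qPoch a q) atTop (𝓝 (qPochInf a q)) := by
  have hs : Summable fun j : ℕ => ‖-(a * q ^ j)‖ := by
    simpa [norm_mul] using (summable_geometric_of_lt_one (norm_nonneg q) hq).mul_left ‖a‖
  have hm := multipliable_one_add_of_summable hs
  simp only [← sub_eq_add_neg] at hm
  exact hm.hasProd.tendsto_prod_nat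

lemma tendsto_tsum_qBinomCoeff {q x : ℂ} (hq : ‖q‖ < 1) (hx : ‖x‖ < 1) (a : ℂ) :
    Tendsto (fun N : ℕ => ∑' n, qBinomCoeff a q n * (q ^ N * x) ^ n) atTop (𝓝 1) := by
  have hzero : ∑' n, qBinomCoeff a q n * (0 : ℂ) ^ n = 1 := by
    rw [tsum_eq_single 0 (fun n hn => by simp [hn])]
    simp [qBinomCoeff_zero]
  rw [← hzero]
  refine tendsto_tsum_of_dominated_convergence (summable_norm_qBinomCoeff_mul_pow hq hx a) ?_ ?_
  · intro n
    have h := ((tendsto_pow_atTop_nhds_zero_of_norm_lt_one hq).mul_const x).pow n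
    rw [zero_mul] at h
    exact h.const_mul _
  · refine Eventually.of_forall fun N n => ?_
    rw [norm_mul, norm_mul, norm_pow, norm_pow, norm_mul, norm_pow]
    gcongr
    exact mul_le_of_le_one_left (norm_nonneg x) (pow_le_one₀ (norm_nonneg q) hq.le)

lemma qPochInf_mul_tsum_qBinomCoeff {q x : ℂ} (hq : ‖q‖ < 1) (hx : ‖x‖ < 1) (a : ℂ) :
    qPochInf x q * ∑' n, qBinomCoeff a q n * x ^ n = qPochInf (a * x) q := by
  have hleft := (tendsto_qPoch_qPochInf hq x).mul_const (∑' n, qBinomCoeff a q n * x ^ n)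
  have hright := (tendsto_qPoch_qPochInf hq (a * x)).mul (tendsto_tsum_qBinomCoeff hq hx a)
  rw [mul_one] at hright
  simp only [qPoch_mul_tsum_qBinomCoeff hq hx a] at hleft
  exact tendsto_nhds_unique hleft hright

lemma qPochInf_ne_zero {q x : ℂ} (hq : ‖q‖ < 1) (hx : ‖x‖ < 1) : qPochInf x q ≠ 0 := by
  have h := qPochInf_mul_tsum_qBinomCoeff hq hx 0
  have hone : qPochInf (0 * x) q = 1 := by simp [qPochInf]
  rw [hone] at h
  exact left_ne_zero_of_mul_eq_one h

/-- The `q`-binomial theorem. -/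
theorem tsum_qBinomCoeff_mul_pow {q x : ℂ} (hq : ‖q‖ < 1) (hx : ‖x‖ < 1) (a : ℂ) :
    ∑' n, qBinomCoeff a q n * x ^ n = qPochInf (a * x) q / qPochInf x q := by
  rw [eq_div_iff (qPochInf_ne_zero hq hx), mul_comm]
  exact qPochInf_mul_tsum_qBinomCoeff hq hx a

lemma qUltra_mul_pow (q β : ℝ) (n : ℕ) (θ : ℝ) (z : ℂ) :
    qUltra q β n θ * z ^ n = ∑ k ∈ Finset.range (n + 1),
      qBinomCoeff β q k * (Complex.exp (-(I * θ)) * z) ^ k *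
        (qBinomCoeff β q (n - k) * (Complex.exp (I * θ) * z) ^ (n - k)) := by
  rw [qUltra, Finset.sum_mul]
  refine Finset.sum_congr rfl fun k hk => ?_
  obtain ⟨m, rfl⟩ := Nat.exists_eq_add_of_le (Nat.lt_succ_iff.mp (Finset.mem_range.mp hk))
  have hexp : Complex.exp (I * (((k + m : ℕ) : ℂ) - 2 * (k : ℂ)) * (θ : ℂ)) =
      Complex.exp (-(I * θ)) ^ k * Complex.exp (I * θ) ^ m := by
    rw [← Complex.exp_nat_mul, ← Complex.exp_nat_mul, ← Complex.exp_add]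
    congr 1
    push_cast
    ring
  rw [hexp, Nat.add_sub_cancel_left, qBinomCoeff, qBinomCoeff, mul_div_mul_comm, mul_pow, mul_pow,
    pow_add]
  ring

/-- Generating function for the continuous `q`-ultraspherical polynomials:
`((βe^{iθ}z;q)_∞ (βe^{−iθ}z;q)_∞) / ((e^{iθ}z;q)_∞ (e^{−iθ}z;q)_∞)
  = ∑_{n=0}^∞ C_n(cos θ; β | q) z^n` for `0 < q < 1`, `−1 < β < 1`, `θ ∈ [0,π]`, `‖z‖ < 1`. -/
theorem qUltra_generating_function (q β : ℝ) (hq0 : 0 < q) (hq1 : q < 1)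
    (hβ0 : -1 < β) (hβ1 : β < 1) (θ : ℝ) (hθ0 : 0 ≤ θ) (hθ1 : θ ≤ Real.pi)
    (z : ℂ) (hz : ‖z‖ < 1) :
    HasSum (fun n : ℕ => qUltra q β n θ * z ^ n)
      (qPochInf ((β : ℂ) * Complex.exp (I * θ) * z) q *
        qPochInf ((β : ℂ) * Complex.exp (-(I * θ)) * z) q /
        (qPochInf (Complex.exp (I * θ) * z) q *
          qPochInf (Complex.exp (-(I * θ)) * z) q)) := by
  have hq : ‖(q : ℂ)‖ < 1 := by
    rwa [Complex.norm_real, Real.norm_of_nonneg hq0.le]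
  have hx : ‖Complex.exp (I * θ) * z‖ < 1 := by
    rwa [norm_mul, Complex.norm_exp_I_mul_ofReal, one_mul]
  have hy : ‖Complex.exp (-(I * θ)) * z‖ < 1 := by
    have h := Complex.norm_exp_I_mul_ofReal (-θ)
    rw [Complex.ofReal_neg, mul_neg] at h
    rwa [norm_mul, h, one_mul]
  have h := hasSum_sum_range_mul_of_summable_norm
    (summable_norm_qBinomCoeff_mul_pow hq hy β) (summable_norm_qBinomCoeff_mul_pow hq hx β)
  simp only [← qUltra_mul_pow] at h
  rw [tsum_qBinomCoeff_mul_pow hq hx, tsum_qBinomCoeff_mul_pow hq hy, mul_comm,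
    div_mul_div_comm, ← mul_assoc, ← mul_assoc] at h
  exact h
end
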